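/- Let C, m, k be natural numbers with m ≥ 2 and k ≥ 1, let k_0, …, k_C be natural numbers with Σ_{i=0}^{C} k_i = k, and let r, c_0, β be positive real numbers and ε, γ ∈ (0,1). Define the density estimates p̂_i = c_0·k_i/(k·r^{m-1}) for i = 0, …, C, set p̂_{C+1} = 1 if max_{0≤i≤C} p̂_i ≤ β and p̂_{C+1} = 0 otherwise, and define the estimated unknown-class posterior P = ((1−ε)·p̂_{C+1}) / (ε·Σ_{i=0}^{C} p̂_i + (1−ε)·p̂_{C+1}). If c_0·(max_{0≤i≤C} k_i)/(k·r^{m-1}) ≤ β, then P < γ if and only if r^{m-1} < ε·c_0·γ/((1−γ)·(1−ε)). -/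

import Mathlib

/-- Proposition 1 of "Provably Uncertainty-Guided Universal Domain Adaptation":
under the filtering condition `c0 * kmax / (k * r^(m-1)) ≤ β`, the estimated
unknown-class posterior `P` satisfies `P < γ ↔ r^(m-1) < ε·c0·γ/((1-γ)(1-ε))`. -/
theorem stmt_0 (C m k : ℕ) (hm : 2 ≤ m) (hk : 1 ≤ k)
    (ki : Fin (C + 1) → ℕ) (hsum : ∑ i, ki i = k)
    (r c0 β : ℝ) (hr : 0 < r) (hc0 : 0 < c0) (hβ : 0 < β)
    (ε γ : ℝ) (hε : ε ∈ Set.Ioo (0 : ℝ) 1) (hγ : γ ∈ Set.Ioo (0 : ℝ) 1)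
    (p : Fin (C + 1) → ℝ) (hp : ∀ i, p i = c0 * (ki i : ℝ) / (k * r ^ (m - 1)))
    (punk : ℝ)
    (hpunk : punk = if Finset.univ.sup' Finset.univ_nonempty p ≤ β then (1 : ℝ) else 0)
    (P : ℝ) (hP : P = ((1 - ε) * punk) / (ε * ∑ i, p i + (1 - ε) * punk))
    (hcond : c0 * ((Finset.univ.sup ki : ℕ) : ℝ) / (k * r ^ (m - 1)) ≤ β) :
    P < γ ↔ r ^ (m - 1) < ε * c0 * γ / ((1 - γ) * (1 - ε)) := by
  obtain ⟨hε0, hε1⟩ := hε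
  obtain ⟨hγ0, hγ1⟩ := hγ
  have hkR : (0 : ℝ) < k := by exact_mod_cast hk
  have hR : 0 < r ^ (m - 1) := pow_pos hr _
  generalize r ^ (m - 1) = R at *
  have hmax : Finset.univ.sup' Finset.univ_nonempty p ≤ β := by
    apply Finset.sup'_le
    intro i _
    rw [hp i]
    refine le_trans ?_ hcond
    have h : (ki i : ℝ) ≤ ((Finset.univ.sup ki : ℕ) : ℝ) := by
      exact_mod_cast Finset.le_sup (f := ki) (Finset.mem_univ i)
    gcongr
  rw [if_pos hmax] at hpunk
  have hs : ∑ i, p i = c0 / R := by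
    have h : ∑ i, (ki i : ℝ) = k := by exact_mod_cast hsum
    simp only [hp]
    rw [← Finset.sum_div, ← Finset.mul_sum, h]
    field_simp
  have h1 : 0 < 1 - ε := by linarith
  have h2 : 0 < 1 - γ := by linarith
  have hP2 : P = (1 - ε) * R / (ε * c0 + (1 - ε) * R) := by
    rw [hP, hs, hpunk]
    field_simp
  rw [hP2, div_lt_iff₀ (by positivity), lt_div_iff₀ (by positivity)]
  constructor <;> intro h <;> nlinarith
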